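/- There exist a set C of 329 three-dimensional F₂-linear subspaces of F₂⁷, any two distinct members of which intersect in a subspace of dimension at most 1, and a subgroup U of GL(7,F₂) of order 16, such that C is invariant under every element of U. -/

import Mathlib

/-- The ambient vector space `F₂⁷`. -/
abbrev V : Type := Fin 7 → ZMod 2

/-- `GL(7,F₂)` acts on the subspaces of `F₂⁷` by mapping each subspace to its image
under the associated linear automorphism. -/
noncomputable instance : MulAction (GL (Fin 7) (ZMod 2)) (Submodule (ZMod 2) V) where
  smul M W := W.map (Matrix.mulVecLin (M : Matrix (Fin 7) (Fin 7) (ZMod 2)))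
  one_smul W := by
    show W.map _ = W
    simp
  mul_smul M N W := by
    show W.map _ = (W.map _).map _
    rw [← Submodule.map_comp]
    simp [Matrix.mulVecLin_mul]

/-- `C` is a `(7,4;3)₂` constant dimension code: a set of `3`-dimensional subspaces of `F₂⁷`
any two distinct members of which intersect in a subspace of dimension at most `1`. -/
def IsCode (C : Set (Submodule (ZMod 2) V)) : Prop :=
  (∀ W ∈ C, Module.finrank (ZMod 2) W = 3) ∧
  ∀ W₁ ∈ C, ∀ W₂ ∈ C, W₁ ≠ W₂ → Module.finrank (ZMod 2) ↥(W₁ ⊓ W₂) ≤ 1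

open Pointwise in
/-- The automorphism group of `C`: the setwise stabilizer of `C` in `GL(7,F₂)`,
i.e. all `M` with `C · M = C`. -/
noncomputable def Aut (C : Set (Submodule (ZMod 2) V)) : Subgroup (GL (Fin 7) (ZMod 2)) :=
  MulAction.stabilizer (GL (Fin 7) (ZMod 2)) C

/-- `C` is invariant under every element of the subgroup `U` of `GL(7,F₂)`. -/
def Invariant (U : Subgroup (GL (Fin 7) (ZMod 2))) (C : Set (Submodule (ZMod 2) V)) : Prop :=
  ∀ M ∈ U, ∀ W ∈ C, M • W ∈ C

/-- The vector of `F₂⁷` whose coordinates are the binary digits of `n`. -/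
def vec (n : ℕ) : V := fun i => if n.testBit i then 1 else 0

/-- The matrix whose `j`-th column is `vec (g j)`. -/
def mat (g : Fin 7 → ℕ) : Matrix (Fin 7) (Fin 7) (ZMod 2) := Matrix.of fun i j => vec (g j) i

/-- The action of `mat g` on vectors encoded by their binary digits. -/
def act (g : Fin 7 → ℕ) (x : ℕ) : ℕ :=
  (List.finRange 7).foldr (fun (j : Fin 7) y => (if x.testBit j then g j else 0) ^^^ y) 0

/-- The action of `mat g` on encoded bases. -/
def actBasis (g : Fin 7 → ℕ) (t : ℕ × ℕ × ℕ) : ℕ × ℕ × ℕ :=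
  (act g t.1, act g t.2.1, act g t.2.2)

/-- The encoded linear combinations of an encoded basis. -/
def points : ℕ × ℕ × ℕ → List ℕ
  | (a, b, c) => [0, a, b, a ^^^ b, c, a ^^^ c, b ^^^ c, a ^^^ b ^^^ c]

/-- The subspace spanned by an encoded basis. -/
def plane (t : ℕ × ℕ × ℕ) : Submodule (ZMod 2) V :=
  Submodule.span (ZMod 2) {vec t.1, vec t.2.1, vec t.2.2}

/-- The bit mask of a list of natural numbers. -/
def mask (l : List ℕ) : ℕ := l.foldr (fun x m => 2 ^ x ||| m) 0

/-- The encoded elements of the prescribed group. -/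
def groupList : List (Fin 7 → ℕ) :=
  [![1, 2, 4, 8, 16, 32, 64], ![9, 18, 36, 8, 16, 32, 64],
   ![33, 34, 44, 8, 16, 32, 88], ![41, 50, 12, 8, 16, 32, 88],
   ![68, 47, 2, 32, 56, 16, 88], ![74, 81, 23, 16, 8, 56, 64],
   ![84, 63, 50, 32, 56, 16, 64], ![87, 36, 81, 56, 32, 8, 88],
   ![90, 89, 47, 16, 8, 56, 64], ![95, 44, 97, 56, 32, 8, 64],
   ![98, 97, 7, 16, 8, 56, 88], ![100, 23, 18, 32, 56, 16, 88],
   ![103, 12, 105, 56, 32, 8, 64], ![111, 4, 89, 56, 32, 8, 88],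
   ![114, 105, 63, 16, 8, 56, 88], ![116, 7, 34, 32, 56, 16, 64]]

/-- Encoded bases of representatives of the orbits of the prescribed group on the code. -/
def orbitReps : List (ℕ × ℕ × ℕ) :=
  [(24, 40, 64), (3, 24, 32), (11, 19, 67), (1, 40, 74), (2, 48, 81), (3, 5, 112),
   (3, 28, 40), (3, 48, 76), (5, 40, 72), (8, 21, 32), (11, 21, 64), (21, 38, 78),
   (1, 2, 88), (1, 8, 64), (1, 18, 96), (2, 16, 104), (3, 21, 109), (5, 8, 51),
   (10, 49, 65), (10, 51, 66), (1, 4, 34), (1, 6, 66), (1, 10, 52), (1, 12, 48),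
   (1, 14, 80), (1, 20, 70), (1, 22, 102), (1, 24, 46), (1, 30, 100), (1, 36, 78),
   (2, 4, 49), (2, 29, 77), (2, 52, 69), (2, 60, 64)]

/-- Encoded bases of the codewords, possibly with several bases for one codeword. -/
def codeBases : List (ℕ × ℕ × ℕ) :=
  orbitReps.flatMap fun t => groupList.map fun g => actBasis g t

theorem groupList_mul_mem :
    ∀ g ∈ groupList, ∀ h ∈ groupList, ∃ k ∈ groupList, ∀ j, act g (h j) = k j := by
  decide +kernel

theorem groupList_exists_inv :
    ∀ g ∈ groupList, ∃ h ∈ groupList, ∀ j : Fin 7, act g (h j) = 2 ^ (j : ℕ) := by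
  decide +kernel

theorem groupList_one_mem : ∃ g ∈ groupList, ∀ j : Fin 7, g j = 2 ^ (j : ℕ) := by
  decide +kernel

theorem groupList_lt : ∀ g ∈ groupList, ∀ j, g j < 128 := by
  decide +kernel

theorem card_groupList : groupList.toFinset.card = 16 := by
  decide +kernel

theorem orbitReps_nodup : ∀ t ∈ orbitReps, (points t).Nodup := by
  decide +kernel

theorem orbitReps_lt : ∀ t ∈ orbitReps, t.1 < 128 ∧ t.2.1 < 128 ∧ t.2.2 < 128 := by
  decide +kernel

theorem codeBases_lt : ∀ t ∈ codeBases, t.1 < 128 ∧ t.2.1 < 128 ∧ t.2.2 < 128 := by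
  decide +kernel

theorem codeBases_inter_orbitReps : ∀ s ∈ codeBases, ∀ t ∈ orbitReps,
    mask (points t) = mask (points s) ∨
      (mask (points t) &&& mask (points s)) / 2 &&&
        ((mask (points t) &&& mask (points s)) / 2 - 1) = 0 := by
  decide +kernel

theorem card_mask_codeBases :
    (codeBases.map fun t => mask (points t)).toFinset.card = 329 := by
  decide +kernel

theorem vec_xor (a b : ℕ) : vec (a ^^^ b) = vec a + vec b := by
  ext i
  simp only [vec, Nat.testBit_xor, Pi.add_apply]
  cases a.testBit i <;> cases b.testBit i <;> decide

theorem vec_zero : vec 0 = 0 := by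
  ext i
  simp [vec]

theorem vec_injOn : Set.InjOn vec {n | n < 128} := by
  intro a ha b hb h
  have ha' : a < 2 ^ 7 := ha
  have hb' : b < 2 ^ 7 := hb
  refine Nat.eq_of_testBit_eq fun i => ?_
  rcases lt_or_ge i 7 with hi | hi
  · have := congrFun h ⟨i, hi⟩
    simp only [vec] at this
    cases h1 : a.testBit i <;> cases h2 : b.testBit i <;> simp_all
  · rw [Nat.testBit_lt_two_pow (ha'.trans_le (Nat.pow_le_pow_right two_pos hi)),
      Nat.testBit_lt_two_pow (hb'.trans_le (Nat.pow_le_pow_right two_pos hi))]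

theorem mat_mulVec_vec (g : Fin 7 → ℕ) (x : ℕ) : (mat g).mulVec (vec x) = vec (act g x) := by
  have key (l : List (Fin 7)) :
      vec (l.foldr (fun (j : Fin 7) y => (if x.testBit j then g j else 0) ^^^ y) 0) =
        (l.map fun j => vec x j • vec (g j)).sum := by
    induction l with
    | nil => exact vec_zero
    | cons j l ih =>
      rw [List.foldr_cons, vec_xor, ih, List.map_cons, List.sum_cons]
      congr 1
      cases h : x.testBit j <;> simp [h, vec_zero, vec.eq_1 x]
  rw [act, key, ← Fin.sum_univ_def]
  ext i
  simp [Matrix.mulVec, dotProduct, mat, mul_comm]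

theorem vec_two_pow (j : Fin 7) : vec (2 ^ (j : ℕ)) = Pi.single j 1 := by
  ext i
  simp [vec, Nat.testBit_two_pow, Pi.single_apply, Fin.ext_iff, eq_comm]

theorem mat_two_pow : mat (fun j => 2 ^ (j : ℕ)) = 1 := by
  ext i j
  simp [mat, vec_two_pow, Matrix.one_apply, Pi.single_apply]

theorem mat_mul (g h : Fin 7 → ℕ) : mat g * mat h = mat fun j => act g (h j) := by
  ext i j
  exact congrFun (mat_mulVec_vec g (h j)) i

theorem mat_injOn : Set.InjOn mat {g | ∀ j, g j < 128} := by
  intro g hg h hh e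
  ext j
  exact vec_injOn (hg j) (hh j) (funext fun i => congrFun (congrFun e i) j)

theorem mem_plane {t : ℕ × ℕ × ℕ} {v : V} : v ∈ plane t ↔ ∃ n ∈ points t, vec n = v := by
  obtain ⟨a, b, c⟩ := t
  have two (x : ZMod 2) : x = 0 ∨ x = 1 := by decide +revert
  simp only [plane, points, Submodule.mem_span_triple]
  constructor
  · rintro ⟨x, y, z, rfl⟩
    rcases two x with rfl | rfl <;> rcases two y with rfl | rfl <;>
      rcases two z with rfl | rfl <;> simp [vec_xor, vec_zero]
  · rintro ⟨n, hn, rfl⟩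
    simp only [List.mem_cons, List.not_mem_nil, or_false] at hn
    rcases hn with rfl | rfl | rfl | rfl | rfl | rfl | rfl | rfl
    · exact ⟨0, 0, 0, by simp [vec_zero]⟩
    · exact ⟨1, 0, 0, by simp⟩
    · exact ⟨0, 1, 0, by simp⟩
    · exact ⟨1, 1, 0, by simp [vec_xor]⟩
    · exact ⟨0, 0, 1, by simp⟩
    · exact ⟨1, 0, 1, by simp [vec_xor]⟩
    · exact ⟨0, 1, 1, by simp [vec_xor]⟩
    · exact ⟨1, 1, 1, by simp [vec_xor]⟩

theorem testBit_mask {l : List ℕ} {x : ℕ} : (mask l).testBit x = true ↔ x ∈ l := by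
  induction l with
  | nil => simp [mask]
  | cons a l ih =>
    have : mask (a :: l) = 2 ^ a ||| mask l := rfl
    rw [this, Nat.testBit_or, Nat.testBit_two_pow, Bool.or_eq_true, decide_eq_true_iff, ih,
      List.mem_cons, eq_comm]

/-- The encoded bases all of whose vectors have seven binary digits. -/
def validBases : Set (ℕ × ℕ × ℕ) := {t | t.1 < 128 ∧ t.2.1 < 128 ∧ t.2.2 < 128}

theorem points_lt {t : ℕ × ℕ × ℕ} (ht : t ∈ validBases) : ∀ n ∈ points t, n < 128 := by
  obtain ⟨a, b, c⟩ := t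
  obtain ⟨ha, hb, hc⟩ := ht
  have xor_lt {x y : ℕ} (hx : x < 128) (hy : y < 128) : x ^^^ y < 128 :=
    Nat.xor_lt_two_pow (n := 7) hx hy
  simp only [points, List.forall_mem_cons]
  exact ⟨by norm_num, ha, hb, xor_lt ha hb, hc, xor_lt ha hc, xor_lt hb hc,
    xor_lt (xor_lt ha hb) hc, by simp⟩

theorem vec_mem_plane {t : ℕ × ℕ × ℕ} (ht : t ∈ validBases) {n : ℕ} (hn : n < 128) :
    vec n ∈ plane t ↔ n ∈ points t := by
  rw [mem_plane]
  refine ⟨fun ⟨m, hm, e⟩ => ?_, fun h => ⟨n, h, rfl⟩⟩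
  rwa [← vec_injOn (points_lt ht m hm) hn e]

theorem plane_le_of_mask_eq {t s : ℕ × ℕ × ℕ} (h : mask (points t) = mask (points s)) :
    plane t ≤ plane s := by
  intro v hv
  obtain ⟨n, hn, rfl⟩ := mem_plane.1 hv
  exact mem_plane.2 ⟨n, by rwa [← testBit_mask, ← h, testBit_mask], rfl⟩

theorem plane_eq_iff {t s : ℕ × ℕ × ℕ} (ht : t ∈ validBases) (hs : s ∈ validBases) :
    plane t = plane s ↔ mask (points t) = mask (points s) := by
  refine ⟨fun h => Nat.eq_of_testBit_eq fun x => ?_,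
    fun h => le_antisymm (plane_le_of_mask_eq h) (plane_le_of_mask_eq h.symm)⟩
  rw [Bool.eq_iff_iff, testBit_mask, testBit_mask]
  constructor
  · intro hx
    rwa [← vec_mem_plane hs (points_lt ht x hx), ← h, vec_mem_plane ht (points_lt ht x hx)]
  · intro hx
    rwa [← vec_mem_plane ht (points_lt hs x hx), h, vec_mem_plane hs (points_lt hs x hx)]

theorem finrank_plane {t : ℕ × ℕ × ℕ} (ht : t ∈ validBases) (hn : (points t).Nodup) :
    Module.finrank (ZMod 2) (plane t) = 3 := by
  have hset : (plane t : Set V) = vec '' ((points t).toFinset : Set ℕ) := by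
    ext v
    simp [mem_plane]
  have hcard : (plane t : Set V).ncard = 2 ^ 3 := by
    rw [hset, Set.InjOn.ncard_image, Set.ncard_coe_finset, List.toFinset_card_of_nodup hn]
    · rfl
    · exact vec_injOn.mono fun n hm => points_lt ht n (by simpa using hm)
  have hpow := Module.natCard_eq_pow_finrank (K := ZMod 2) (V := plane t)
  rw [Nat.card_zmod] at hpow
  exact Nat.pow_right_injective le_rfl (hpow.symm.trans hcard)

theorem exists_forall_testBit_of_and_sub_one_eq_zero {m : ℕ} (h : m / 2 &&& (m / 2 - 1) = 0) :
    ∃ k, ∀ n, m.testBit n = true → n = 0 ∨ n = k := by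
  rcases eq_or_ne (m / 2) 0 with h0 | h0
  · refine ⟨0, fun n hn => ?_⟩
    cases n with
    | zero => exact Or.inl rfl
    | succ n => simp [Nat.testBit_succ, h0] at hn
  · obtain ⟨k, hk⟩ := (Nat.and_sub_one_eq_zero_iff_isPowerOfTwo h0).1 h
    refine ⟨k + 1, fun n hn => ?_⟩
    cases n with
    | zero => exact Or.inl rfl
    | succ n =>
      rw [Nat.testBit_succ, hk, Nat.testBit_two_pow, decide_eq_true_iff] at hn
      exact Or.inr (by rw [hn])

theorem finrank_plane_inf_le {t s : ℕ × ℕ × ℕ} (ht : t ∈ validBases) (hs : s ∈ validBases)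
    (h : (mask (points t) &&& mask (points s)) / 2 &&&
      ((mask (points t) &&& mask (points s)) / 2 - 1) = 0) :
    Module.finrank (ZMod 2) ↥(plane t ⊓ plane s) ≤ 1 := by
  obtain ⟨k, hk⟩ := exists_forall_testBit_of_and_sub_one_eq_zero h
  have hle : plane t ⊓ plane s ≤ Submodule.span (ZMod 2) {vec k} := by
    rintro v ⟨hvt, hvs⟩
    obtain ⟨n, hn, rfl⟩ := mem_plane.1 hvt
    have hn' := (vec_mem_plane hs (points_lt ht n hn)).1 hvs
    rcases hk n (by rw [Nat.testBit_and, testBit_mask.2 hn, testBit_mask.2 hn']; rfl) with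
      rfl | rfl
    · simp [vec_zero]
    · exact Submodule.mem_span_singleton_self _
  refine (Submodule.finrank_mono hle).trans ((finrank_span_le_card _).trans ?_)
  simp

theorem smul_plane {M : GL (Fin 7) (ZMod 2)} {g : Fin 7 → ℕ}
    (h : (M : Matrix (Fin 7) (Fin 7) (ZMod 2)) = mat g) (t : ℕ × ℕ × ℕ) :
    M • plane t = plane (actBasis g t) := by
  change Submodule.map (Matrix.mulVecLin (M : Matrix (Fin 7) (Fin 7) (ZMod 2))) _ = _
  simp [h, plane, actBasis, Submodule.map_span, Set.image_insert_eq, mat_mulVec_vec]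

theorem mulVecLin_injective (M : GL (Fin 7) (ZMod 2)) :
    Function.Injective (Matrix.mulVecLin (M : Matrix (Fin 7) (Fin 7) (ZMod 2))) :=
  Matrix.mulVec_injective_of_isUnit M.isUnit

theorem finrank_smul (M : GL (Fin 7) (ZMod 2)) (W : Submodule (ZMod 2) V) :
    Module.finrank (ZMod 2) ↥(M • W) = Module.finrank (ZMod 2) W :=
  (Submodule.equivMapOfInjective _ (mulVecLin_injective M) W).finrank_eq.symm

theorem smul_inf (M : GL (Fin 7) (ZMod 2)) (W₁ W₂ : Submodule (ZMod 2) V) :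
    M • (W₁ ⊓ W₂) = M • W₁ ⊓ M • W₂ :=
  Submodule.map_inf _ (mulVecLin_injective M)

/-- The prescribed group of order `16`. -/
def prescribedGroup : Subgroup (GL (Fin 7) (ZMod 2)) where
  carrier := {M | ∃ g ∈ groupList, (M : Matrix (Fin 7) (Fin 7) (ZMod 2)) = mat g}
  one_mem' := by
    obtain ⟨g, hg, h⟩ := groupList_one_mem
    refine ⟨g, hg, ?_⟩
    rw [funext h, mat_two_pow, Units.val_one]
  mul_mem' := by
    rintro M N ⟨g, hg, hM⟩ ⟨h, hh, hN⟩
    obtain ⟨k, hk, e⟩ := groupList_mul_mem g hg h hh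
    refine ⟨k, hk, ?_⟩
    rw [Units.val_mul, hM, hN, mat_mul, funext e]
  inv_mem' := by
    rintro M ⟨g, hg, hM⟩
    obtain ⟨h, hh, e⟩ := groupList_exists_inv g hg
    refine ⟨h, hh, Units.inv_eq_of_mul_eq_one_right ?_⟩
    rw [hM, mat_mul, funext e, mat_two_pow]

theorem exists_mem_prescribedGroup {g : Fin 7 → ℕ} (hg : g ∈ groupList) :
    ∃ M ∈ prescribedGroup, (M : Matrix (Fin 7) (Fin 7) (ZMod 2)) = mat g := by
  obtain ⟨h, -, e⟩ := groupList_exists_inv g hg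
  have hgh : mat g * mat h = 1 := by rw [mat_mul, funext e, mat_two_pow]
  exact ⟨⟨mat g, mat h, hgh, mul_eq_one_comm.1 hgh⟩, ⟨g, hg, rfl⟩, rfl⟩

theorem card_prescribedGroup : Nat.card prescribedGroup = 16 := by
  have himage : Units.val '' (prescribedGroup : Set (GL (Fin 7) (ZMod 2))) =
      mat '' (groupList.toFinset : Set (Fin 7 → ℕ)) := by
    ext A
    constructor
    · rintro ⟨M, ⟨g, hg, hM⟩, rfl⟩
      exact ⟨g, by simpa using hg, hM.symm⟩
    · rintro ⟨g, hg, rfl⟩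
      exact exists_mem_prescribedGroup (by simpa using hg)
  calc Nat.card prescribedGroup
      = (Units.val '' (prescribedGroup : Set (GL (Fin 7) (ZMod 2)))).ncard :=
        (Set.ncard_image_of_injective _ Units.val_injective).symm
    _ = 16 := by
      rw [himage, Set.InjOn.ncard_image, Set.ncard_coe_finset, card_groupList]
      exact mat_injOn.mono fun g hg => groupList_lt g (by simpa using hg)

/-- The code with the encoded bases `codeBases`. -/
def code : Set (Submodule (ZMod 2) V) := plane '' {t | t ∈ codeBases}

theorem mem_code {W : Submodule (ZMod 2) V} :
    W ∈ code ↔ ∃ M ∈ prescribedGroup, ∃ t ∈ orbitReps, M • plane t = W := by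
  constructor
  · rintro ⟨s, hs, rfl⟩
    obtain ⟨t, ht, hs⟩ := List.mem_flatMap.1 hs
    obtain ⟨g, hg, rfl⟩ := List.mem_map.1 hs
    obtain ⟨M, hM, e⟩ := exists_mem_prescribedGroup hg
    exact ⟨M, hM, t, ht, smul_plane e t⟩
  · rintro ⟨M, ⟨g, hg, e⟩, t, ht, rfl⟩
    exact ⟨actBasis g t, List.mem_flatMap.2 ⟨t, ht, List.mem_map.2 ⟨g, hg, rfl⟩⟩,
      (smul_plane e t).symm⟩

theorem invariant_code : Invariant prescribedGroup code := by
  intro M hM W hW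
  obtain ⟨N, hN, t, ht, rfl⟩ := mem_code.1 hW
  exact mem_code.2 ⟨M * N, mul_mem hM hN, t, ht, mul_smul M N _⟩

theorem isCode_code : IsCode code := by
  refine ⟨fun W hW => ?_, fun W₁ h₁ W₂ h₂ hne => ?_⟩
  · obtain ⟨M, -, t, ht, rfl⟩ := mem_code.1 hW
    rw [finrank_smul, finrank_plane (orbitReps_lt t ht) (orbitReps_nodup t ht)]
  · obtain ⟨M, hM, t, ht, rfl⟩ := mem_code.1 h₁
    obtain ⟨s, hs, e⟩ := invariant_code M⁻¹ (inv_mem hM) W₂ h₂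
    obtain rfl : M • plane s = W₂ := by rw [e, smul_inv_smul]
    rw [← smul_inf, finrank_smul]
    rcases codeBases_inter_orbitReps s hs t ht with h | h
    · have heq := (plane_eq_iff (orbitReps_lt t ht) (codeBases_lt s hs)).2 h
      exact absurd (congrArg (M • ·) heq) hne
    · exact finrank_plane_inf_le (orbitReps_lt t ht) (codeBases_lt s hs) h

theorem ncard_image_eq_of_eq_iff {α β γ : Type*} {f : α → β} {g : α → γ} {s : Set α}
    (h : ∀ a ∈ s, ∀ b ∈ s, f a = f b ↔ g a = g b) : (f '' s).ncard = (g '' s).ncard := by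
  obtain ⟨r, hrs, hr⟩ := Set.exists_subset_bijOn s f
  have hg : Set.InjOn g r := fun a ha b hb e => hr.injOn ha hb ((h a (hrs ha) b (hrs hb)).2 e)
  have himage : g '' s = g '' r := by
    refine (Set.image_mono hrs).antisymm' ?_
    rintro _ ⟨a, ha, rfl⟩
    obtain ⟨b, hb, e⟩ := hr.surjOn ⟨a, ha, rfl⟩
    exact ⟨b, hb, (h b (hrs hb) a ha).1 e⟩
  rw [← hr.image_eq, himage, hr.injOn.ncard_image, hg.ncard_image]

theorem ncard_code : code.ncard = 329 := by
  have himage : (fun t => mask (points t)) '' {t | t ∈ codeBases} =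
      ((codeBases.map fun t => mask (points t)).toFinset : Set ℕ) := by
    ext m
    simp
  have hncard : code.ncard = ((fun t => mask (points t)) '' {t | t ∈ codeBases}).ncard :=
    ncard_image_eq_of_eq_iff
      fun t ht s hs => plane_eq_iff (codeBases_lt t ht) (codeBases_lt s hs)
  rw [hncard, himage, Set.ncard_coe_finset, card_mask_codeBases]

/-- There is a `(7,4;3)₂` code of size 329 invariant under a subgroup
of `GL(7,F₂)` of order 16. -/
theorem stmt_13 :
    ∃ (C : Set (Submodule (ZMod 2) V)) (U : Subgroup (GL (Fin 7) (ZMod 2))),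
      IsCode C ∧ C.ncard = 329 ∧ Nat.card U = 16 ∧ Invariant U C := by
  exact ⟨code, prescribedGroup, isCode_code, ncard_code, card_prescribedGroup, invariant_code⟩
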